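/- For every nonnegative integer m, lim_{n→∞} P(f⁺_{[0,2n−2]}(R_n'') = m) = Σ_{i=0}^{m} [lim_{n→∞} P(f⁺_{[0,n−1]}(R_n') = i)] · [lim_{n→∞} P(f⁺_{[0,n−1]}(R_n') = m−i)], where all the indicated limits exist. -/

import Mathlib

open Finset Filter

open Classical in
/-- The number of missing sums of `R` in the integer interval `[a, b]`, i.e.
`#{k ∈ ℤ ∩ [a,b] : k ∉ R + R}` where `R + R = {x + y : x, y ∈ R}`. -/
noncomputable def missSum (R : Finset ℕ) (a b : ℤ) : ℕ :=
  ((Finset.Icc a b).filter (fun k => ¬ ∃ x ∈ R, ∃ y ∈ R, (x : ℤ) + (y : ℤ) = k)).card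

open Classical in
/-- The number of missing differences of `R` in the integer interval `[a, b]`, i.e.
`#{k ∈ ℤ ∩ [a,b] : k ∉ R - R}` where `R - R = {x - y : x, y ∈ R}`. -/
noncomputable def missDiff (R : Finset ℕ) (a b : ℤ) : ℕ :=
  ((Finset.Icc a b).filter (fun k => ¬ ∃ x ∈ R, ∃ y ∈ R, (x : ℤ) - (y : ℤ) = k)).card

open Classical in
/-- The probability that the random set `R_n` — a subset of `{0,…,n-1}` in which each
element is included independently with probability `1/2`, i.e. a uniformly random
subset of `{0,…,n-1}` — satisfies the event `p`. -/
noncomputable def pR (n : ℕ) (p : Finset ℕ → Prop) : ℝ :=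
  (((Finset.range n).powerset.filter p).card : ℝ) / 2 ^ n

open Classical in
/-- The probability that the random set `R_n'` — a uniformly random subset of
`{0,…,n-1}` conditioned on containing `0` — satisfies the event `p`. -/
noncomputable def pR' (n : ℕ) (p : Finset ℕ → Prop) : ℝ :=
  (((Finset.range n).powerset.filter (fun S => 0 ∈ S ∧ p S)).card : ℝ) / 2 ^ (n - 1)

open Classical in
/-- The probability that the random set `R_n''` — a uniformly random subset of
`{0,…,n-1}` conditioned on containing both `0` and `n-1` — satisfies the event `p`. -/
noncomputable def pR'' (n : ℕ) (p : Finset ℕ → Prop) : ℝ :=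
  (((Finset.range n).powerset.filter (fun S => 0 ∈ S ∧ n - 1 ∈ S ∧ p S)).card : ℝ) / 2 ^ (n - 2)

open Classical in
/-- The probability that the random set `R_∞` — a subset of `ℕ` in which each
nonnegative integer is included independently with probability `1/2` — satisfies the
event `p`, for an event `p` depending only on the elements `< N` of the set.  Since
each of the `2^N` possibilities for `R_∞ ∩ {0,…,N-1}` is equally likely and `p` is
determined by this intersection, the probability is obtained by counting. -/
noncomputable def probInf (N : ℕ) (p : Finset ℕ → Prop) : ℝ :=
  (((Finset.range N).powerset.filter p).card : ℝ) / 2 ^ N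

open Classical in
/-- The number of subsets of `U` satisfying `p`. -/
noncomputable def subsetCount (U : Finset ℕ) (p : Finset ℕ → Prop) : ℕ :=
  (U.powerset.filter p).card

theorem subsetCount_congr {U : Finset ℕ} {p q : Finset ℕ → Prop}
    (h : ∀ S ⊆ U, (p S ↔ q S)) : subsetCount U p = subsetCount U q := by
  classical
  unfold subsetCount
  congr 1
  ext S
  simp only [mem_filter, mem_powerset]
  constructor
  · rintro ⟨h1, h2⟩; exact ⟨h1, (h S h1).1 h2⟩
  · rintro ⟨h1, h2⟩; exact ⟨h1, (h S h1).2 h2⟩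

theorem subsetCount_mono {U : Finset ℕ} {p q : Finset ℕ → Prop}
    (h : ∀ S ⊆ U, p S → q S) : subsetCount U p ≤ subsetCount U q := by
  classical
  refine card_le_card fun S => ?_
  simp only [mem_filter, mem_powerset]
  rintro ⟨h1, h2⟩
  exact ⟨h1, h S h1 h2⟩

theorem subsetCount_true (U : Finset ℕ) : subsetCount U (fun _ => True) = 2 ^ U.card := by
  simp [subsetCount]

/-- Events on disjoint ground sets are independent. -/
theorem subsetCount_union {U V : Finset ℕ} (hUV : Disjoint U V) {r p q : Finset ℕ → Prop}
    (h : ∀ A ⊆ U, ∀ B ⊆ V, (r (A ∪ B) ↔ p A ∧ q B)) :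
    subsetCount (U ∪ V) r = subsetCount U p * subsetCount V q := by
  classical
  unfold subsetCount
  rw [← card_product]
  symm
  refine card_bij (fun AB _ => AB.1 ∪ AB.2) ?_ ?_ ?_
  · rintro ⟨A, B⟩ hAB
    simp only [mem_product, mem_filter, mem_powerset] at hAB ⊢
    obtain ⟨⟨hA, hp⟩, hB, hq⟩ := hAB
    exact ⟨union_subset_union hA hB, (h A hA B hB).2 ⟨hp, hq⟩⟩
  · rintro ⟨A, B⟩ hAB ⟨A', B'⟩ hAB' heq
    simp only [mem_product, mem_filter, mem_powerset] at hAB hAB' heq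
    obtain ⟨⟨hA, -⟩, hB, -⟩ := hAB
    obtain ⟨⟨hA', -⟩, hB', -⟩ := hAB'
    have hd : ∀ x, x ∈ U → x ∉ V := fun x hx hx' => (Finset.disjoint_left.1 hUV) hx hx'
    have he : ∀ x, (x ∈ A ∨ x ∈ B) ↔ (x ∈ A' ∨ x ∈ B') := by
      intro x; rw [← mem_union, heq, mem_union]
    ext x
    · have := he x; have := hd x; have := @hA x; have := @hA' x; have := @hB x
      have := @hB' x; tauto
    · have := he x; have := hd x; have := @hA x; have := @hA' x; have := @hB x
      have := @hB' x; tauto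
  · intro S hS
    simp only [mem_filter, mem_powerset] at hS
    have hS' : S = S ∩ U ∪ S ∩ V := by
      rw [← inter_union_distrib_left]; exact (inter_eq_left.2 hS.1).symm
    refine ⟨(S ∩ U, S ∩ V), ?_, hS'.symm⟩
    have := (h (S ∩ U) inter_subset_right (S ∩ V) inter_subset_right).1 (hS' ▸ hS.2)
    simp only [mem_product, mem_filter, mem_powerset]
    exact ⟨⟨inter_subset_right, this.1⟩, inter_subset_right, this.2⟩

theorem subsetCount_exists_le {U K : Finset ℕ} (b : ℕ → Finset ℕ → Prop) :
    subsetCount U (fun S => ∃ k ∈ K, b k S) ≤ ∑ k ∈ K, subsetCount U (b k) := by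
  classical
  unfold subsetCount
  refine le_trans (card_le_card ?_) card_biUnion_le
  intro S
  simp only [mem_filter, mem_powerset, mem_biUnion]
  rintro ⟨h, k, hk, hb⟩
  exact ⟨k, hk, h, hb⟩

theorem abs_subsetCount_sub_le {U : Finset ℕ} {p q r : Finset ℕ → Prop}
    (h : ∀ S ⊆ U, ¬ r S → (p S ↔ q S)) :
    |(subsetCount U p : ℝ) - subsetCount U q| ≤ subsetCount U r := by
  classical
  have key : ∀ p q : Finset ℕ → Prop, (∀ S ⊆ U, ¬ r S → (p S ↔ q S)) →
      subsetCount U p ≤ subsetCount U q + subsetCount U r := by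
    intro p q h
    unfold subsetCount
    refine le_trans (card_le_card ?_) (card_union_le _ _)
    intro S
    simp only [mem_filter, mem_powerset, mem_union]
    rintro ⟨hS, hp⟩
    by_cases hr : r S
    · exact Or.inr ⟨hS, hr⟩
    · exact Or.inl ⟨hS, (h S hS hr).1 hp⟩
  have h1 : (subsetCount U p : ℝ) ≤ subsetCount U q + subsetCount U r := by
    exact_mod_cast key p q h
  have h2 : (subsetCount U q : ℝ) ≤ subsetCount U p + subsetCount U r := by
    exact_mod_cast key q p fun S hS hr => (h S hS hr).symm
  rw [abs_le]
  constructor <;> linarith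

theorem subsetCount_pair {x y : ℕ} (hxy : x ≠ y) :
    subsetCount {x, y} (fun S => ¬ (x ∈ S ∧ y ∈ S)) = 3 := by
  classical
  have h : (({x, y} : Finset ℕ).powerset.filter (fun S => ¬ (x ∈ S ∧ y ∈ S))) =
      ({x, y} : Finset ℕ).powerset.erase {x, y} := by
    ext S
    simp only [mem_filter, mem_powerset, mem_erase]
    constructor
    · rintro ⟨h1, h2⟩
      refine ⟨?_, h1⟩
      rintro rfl
      exact h2 (by simp)
    · rintro ⟨h1, h2⟩
      refine ⟨h2, fun h3 => h1 (subset_antisymm h2 ?_)⟩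
      intro z
      simp only [mem_insert, mem_singleton]
      rintro (rfl | rfl)
      exacts [h3.1, h3.2]
  have h' : subsetCount {x, y} (fun S => ¬ (x ∈ S ∧ y ∈ S)) =
      (({x, y} : Finset ℕ).powerset.filter (fun S => ¬ (x ∈ S ∧ y ∈ S))).card := by
    unfold subsetCount; congr!
  rw [h', h, card_erase_of_mem (by simp), card_powerset, card_pair hxy]
  norm_num

/-- Avoiding each of `#J` disjoint pairs `{x, k - x}` has probability `(3/4) ^ #J`. -/
theorem subsetCount_avoid_pairs (k : ℕ) (J : Finset ℕ) : ∀ U : Finset ℕ,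
    (∀ x ∈ J, 2 * x < k ∧ x ∈ U ∧ k - x ∈ U) →
    subsetCount U (fun S => ∀ x ∈ J, ¬ (x ∈ S ∧ k - x ∈ S)) * 4 ^ J.card
      = 3 ^ J.card * 2 ^ U.card := by
  classical
  induction J using Finset.induction_on with
  | empty => intro U _; simp [subsetCount_true]
  | insert a J ha ih =>
    intro U hU
    have haU := hU a (mem_insert_self _ _)
    have hne : a ≠ k - a := by omega
    have hsub : ({a, k - a} : Finset ℕ) ⊆ U := by
      intro z; simp only [mem_insert, mem_singleton]; rintro (rfl | rfl)
      exacts [haU.2.1, haU.2.2]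
    have hne' : ∀ x ∈ J, x ≠ a ∧ x ≠ k - a ∧ k - x ≠ a ∧ k - x ≠ k - a := by
      intro x hx
      have h1 : x ≠ a := fun h => ha (h ▸ hx)
      have := (hU x (mem_insert_of_mem hx)).1
      omega
    have hprod : subsetCount (U \ {a, k - a} ∪ {a, k - a})
        (fun S => ∀ x ∈ insert a J, ¬ (x ∈ S ∧ k - x ∈ S)) =
        subsetCount (U \ {a, k - a}) (fun S => ∀ x ∈ J, ¬ (x ∈ S ∧ k - x ∈ S)) *
        subsetCount {a, k - a} (fun S => ¬ (a ∈ S ∧ k - a ∈ S)) := by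
      refine subsetCount_union sdiff_disjoint ?_
      intro A hA B hB
      have hA1 : a ∉ A := fun h => by simpa using hA h
      have hA2 : k - a ∉ A := fun h => by simpa using hA h
      have hB' : ∀ z, z ≠ a → z ≠ k - a → z ∉ B := fun z h1 h2 h => by
        have := hB h
        simp only [mem_insert, mem_singleton] at this
        tauto
      rw [forall_mem_insert, and_comm]
      simp only [mem_union, hA1, hA2, false_or]
      refine and_congr_left fun _ => forall₂_congr fun x hx => ?_
      obtain ⟨h1, h2, h3, h4⟩ := hne' x hx
      simp [hB' x h1 h2, hB' (k - x) h3 h4]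
    rw [sdiff_union_of_subset hsub, subsetCount_pair hne] at hprod
    have hcard : U.card = (U \ {a, k - a}).card + 2 := by
      rw [← card_pair hne, card_sdiff_add_card_eq_card hsub]
    have hih := ih (U \ {a, k - a}) (by
      intro x hx
      obtain ⟨h1, h2, h3, h4⟩ := hne' x hx
      have := hU x (mem_insert_of_mem hx)
      simp [this, h1, h2, h3, h4])
    rw [hprod, card_insert_of_notMem ha, hcard, pow_succ, pow_succ 3, pow_add]
    linear_combination 12 * hih

/-- `k` is not a sum of two elements of `S`. -/
def IsMissingSum (k : ℕ) (S : Finset ℕ) : Prop := ¬ ∃ x ∈ S, ∃ y ∈ S, x + y = k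

theorem subsetCount_isMissingSum_le_pow {n k j : ℕ} (hj : j ≤ (k + 1) / 2 - (k + 1 - n)) :
    (subsetCount (range n) (IsMissingSum k) : ℝ) ≤ (3 / 4) ^ j * 2 ^ n := by
  have h := subsetCount_avoid_pairs k (Finset.Ico (k + 1 - n) ((k + 1) / 2)) (range n) (by
    intro x hx
    simp only [Finset.mem_Ico, Finset.mem_range] at hx ⊢
    omega)
  rw [Nat.card_Ico, card_range] at h
  set d := (k + 1) / 2 - (k + 1 - n)
  have h' : (subsetCount (range n)
      (fun S => ∀ x ∈ Finset.Ico (k + 1 - n) ((k + 1) / 2), ¬ (x ∈ S ∧ k - x ∈ S)) : ℝ) * 4 ^ d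
      = 3 ^ d * 2 ^ n := by exact_mod_cast h
  have hmono : subsetCount (range n) (IsMissingSum k) ≤ subsetCount (range n)
      (fun S => ∀ x ∈ Finset.Ico (k + 1 - n) ((k + 1) / 2), ¬ (x ∈ S ∧ k - x ∈ S)) := by
    refine subsetCount_mono fun S _ hS x hx hxS => hS ⟨x, hxS.1, k - x, hxS.2, ?_⟩
    simp only [Finset.mem_Ico] at hx
    omega
  calc (subsetCount (range n) (IsMissingSum k) : ℝ)
      ≤ subsetCount (range n)
        (fun S => ∀ x ∈ Finset.Ico (k + 1 - n) ((k + 1) / 2), ¬ (x ∈ S ∧ k - x ∈ S)) := by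
        exact_mod_cast hmono
    _ = (3 / 4) ^ d * 2 ^ n := by rw [div_pow]; field_simp; linarith
    _ ≤ (3 / 4) ^ j * 2 ^ n := by
        gcongr ?_ * _
        exact pow_le_pow_of_le_one (by norm_num) (by norm_num) hj

theorem three_quarters_pow_half_le (k : ℕ) : (3 / 4 : ℝ) ^ ((k + 1) / 2) ≤ (7 / 8) ^ k :=
  calc (3 / 4 : ℝ) ^ ((k + 1) / 2) ≤ ((7 / 8) ^ 2) ^ ((k + 1) / 2) := by
        gcongr; norm_num
    _ = (7 / 8) ^ (2 * ((k + 1) / 2)) := by rw [pow_mul]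
    _ ≤ (7 / 8) ^ k := pow_le_pow_of_le_one (by norm_num) (by norm_num) (by omega)

theorem subsetCount_isMissingSum_le {n k : ℕ} (hk : k < n) :
    (subsetCount (range n) (IsMissingSum k) : ℝ) ≤ (7 / 8) ^ k * 2 ^ n :=
  (subsetCount_isMissingSum_le_pow (j := (k + 1) / 2) (by omega)).trans
    (by gcongr; exact three_quarters_pow_half_le k)

theorem subsetCount_isMissingSum_le' {n k : ℕ} (hk : n ≤ k) (_ : k ≤ 2 * n - 2) :
    (subsetCount (range n) (IsMissingSum k) : ℝ) ≤ (7 / 8) ^ (2 * n - 2 - k) * 2 ^ n :=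
  (subsetCount_isMissingSum_le_pow (j := (2 * n - 2 - k + 1) / 2) (by omega)).trans
    (by gcongr; exact three_quarters_pow_half_le _)

theorem sum_Ico_seven_eighths_pow_le (a b : ℕ) :
    ∑ k ∈ Finset.Ico a b, (7 / 8 : ℝ) ^ k ≤ 8 * (7 / 8) ^ a := by
  rcases le_total a b with h | h
  · rw [geom_sum_Ico (by norm_num) h]
    have : (0 : ℝ) ≤ (7 / 8) ^ b := by positivity
    rw [div_le_iff_of_neg (by norm_num)]
    linarith
  · rw [Finset.Ico_eq_empty_of_le h, sum_empty]
    positivity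

theorem subsetCount_exists_isMissingSum_low_le (n M : ℕ) :
    (subsetCount (range n) (fun S => ∃ k ∈ Finset.Ico M n, IsMissingSum k S) : ℝ)
      ≤ 8 * (7 / 8) ^ M * 2 ^ n :=
  calc (subsetCount (range n) (fun S => ∃ k ∈ Finset.Ico M n, IsMissingSum k S) : ℝ)
      ≤ ∑ k ∈ Finset.Ico M n, (subsetCount (range n) (IsMissingSum k) : ℝ) := by
        exact_mod_cast subsetCount_exists_le _
    _ ≤ ∑ k ∈ Finset.Ico M n, (7 / 8 : ℝ) ^ k * 2 ^ n :=
        sum_le_sum fun k hk => subsetCount_isMissingSum_le (Finset.mem_Ico.1 hk).2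
    _ ≤ _ := by
        rw [← sum_mul]
        gcongr
        exact sum_Ico_seven_eighths_pow_le M n

theorem subsetCount_exists_isMissingSum_mid_le (n M : ℕ) :
    (subsetCount (range n)
      (fun S => ∃ k ∈ Finset.Ico M (2 * n - 1 - M), IsMissingSum k S) : ℝ)
      ≤ 16 * (7 / 8) ^ M * 2 ^ n :=
  calc (subsetCount (range n)
        (fun S => ∃ k ∈ Finset.Ico M (2 * n - 1 - M), IsMissingSum k S) : ℝ)
      ≤ ∑ k ∈ Finset.Ico M (2 * n - 1 - M),
          (subsetCount (range n) (IsMissingSum k) : ℝ) := by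
        exact_mod_cast subsetCount_exists_le _
    _ ≤ ∑ k ∈ Finset.Ico M (2 * n - 1 - M),
          ((7 / 8 : ℝ) ^ k + (7 / 8) ^ (2 * n - 2 - k)) * 2 ^ n := by
        refine sum_le_sum fun k hk => ?_
        have hk' := Finset.mem_Ico.1 hk
        have h1 : (0 : ℝ) ≤ (7 / 8) ^ k := by positivity
        have h2 : (0 : ℝ) ≤ (7 / 8) ^ (2 * n - 2 - k) := by positivity
        rcases lt_or_ge k n with h | h
        · refine (subsetCount_isMissingSum_le h).trans ?_
          gcongr
          linarith
        · refine (subsetCount_isMissingSum_le' h (by omega)).trans ?_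
          gcongr
          linarith
    _ ≤ _ := by
        rw [← sum_mul, sum_add_distrib]
        gcongr
        have h1 := sum_Ico_seven_eighths_pow_le M (2 * n - 1 - M)
        have h2 : ∑ k ∈ Finset.Ico M (2 * n - 1 - M), (7 / 8 : ℝ) ^ (2 * n - 2 - k) =
            ∑ k ∈ Finset.Ico M (2 * n - 1 - M), (7 / 8 : ℝ) ^ k := by
          refine sum_nbij' (fun k => 2 * n - 2 - k) (fun k => 2 * n - 2 - k) ?_ ?_ ?_ ?_ ?_
          all_goals intro k hk
          all_goals simp only [Finset.mem_Ico] at hk ⊢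
          all_goals omega
        linarith

theorem missSum_congr {R T : Finset ℕ} {a b : ℤ}
    (h : ∀ k, a ≤ k → k ≤ b → ((∃ x ∈ R, ∃ y ∈ R, (x : ℤ) + (y : ℤ) = k) ↔
      ∃ x ∈ T, ∃ y ∈ T, (x : ℤ) + (y : ℤ) = k)) : missSum R a b = missSum T a b := by
  classical
  unfold missSum
  congr 1
  refine filter_congr fun k hk => ?_
  rw [Finset.mem_Icc] at hk
  rw [h k hk.1 hk.2]

theorem missSum_add (R : Finset ℕ) {a b c : ℤ} (hab : a ≤ b + 1) (hbc : b ≤ c) :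
    missSum R a c = missSum R a b + missSum R (b + 1) c := by
  classical
  unfold missSum
  rw [← card_union_of_disjoint, ← filter_union]
  · congr 2
    ext k
    simp only [Finset.mem_Icc, mem_union]
    omega
  · rw [Finset.disjoint_left]
    intro k
    simp only [mem_filter, Finset.mem_Icc]
    omega

theorem missSum_eq_zero {R : Finset ℕ} {a b : ℕ} {c d : ℤ} (hc : c = a) (hd : d + 1 ≤ b)
    (h : ¬ ∃ k ∈ Finset.Ico a b, IsMissingSum k R) : missSum R c d = 0 := by
  classical
  unfold missSum
  rw [card_eq_zero, filter_eq_empty_iff]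
  intro k hk hmiss
  rw [Finset.mem_Icc] at hk
  lift k to ℕ using by omega
  refine h ⟨k, Finset.mem_Ico.2 (by omega), ?_⟩
  rintro ⟨x, hx, y, hy, rfl⟩
  exact hmiss ⟨x, hx, y, hy, by push_cast; rfl⟩

/-- Sums below `M` only depend on elements below `M`. -/
theorem missSum_union_low {A B : Finset ℕ} {M : ℕ} (hB : ∀ x ∈ B, M ≤ x) :
    missSum (A ∪ B) 0 ((M : ℤ) - 1) = missSum A 0 ((M : ℤ) - 1) := by
  refine missSum_congr fun k _ hk => ?_
  constructor
  · rintro ⟨x, hx, y, hy, h⟩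
    rw [mem_union] at hx hy
    have hx' := hB x
    have hy' := hB y
    refine ⟨x, hx.resolve_right fun h => ?_, y, hy.resolve_right fun h => ?_, h⟩
    · have := hx' h; omega
    · have := hy' h; omega
  · rintro ⟨x, hx, y, hy, h⟩
    exact ⟨x, mem_union_left _ hx, y, mem_union_left _ hy, h⟩

/-- Among subsets of `{0, …, n - 1}`, sums at least `2 n - 1 - M` only depend on elements at
least `n - M`. -/
theorem missSum_union_high {A B : Finset ℕ} {n M : ℕ} (hM : M ≤ n) (hA : ∀ x ∈ A, x < n - M)
    (hB : ∀ x ∈ B, x < n) :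
    missSum (A ∪ B) (2 * (n : ℤ) - 1 - M) (2 * (n : ℤ) - 2) =
      missSum B (2 * (n : ℤ) - 1 - M) (2 * (n : ℤ) - 2) := by
  refine missSum_congr fun k hk _ => ?_
  constructor
  · rintro ⟨x, hx, y, hy, h⟩
    rw [mem_union] at hx hy
    have hx' := hA x
    have hy' := hA y
    have hx'' := hB x
    have hy'' := hB y
    refine ⟨x, hx.resolve_left fun h => ?_, y, hy.resolve_left fun h => ?_, h⟩
    · have := hx' h
      rcases hy with hy | hy
      · have := hy' hy; omega
      · have := hy'' hy; omega
    · have := hy' h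
      rcases hx with hx | hx
      · have := hx' hx; omega
      · have := hx'' hx; omega
  · rintro ⟨x, hx, y, hy, h⟩
    exact ⟨x, mem_union_right _ hx, y, mem_union_right _ hy, h⟩

theorem missSum_reflect {S : Finset ℕ} {n M : ℕ} (hS : ∀ x ∈ S, x < n) :
    missSum (S.image (fun x => n - 1 - x)) (2 * (n : ℤ) - 1 - M) (2 * (n : ℤ) - 2) =
      missSum S 0 ((M : ℤ) - 1) := by
  classical
  unfold missSum
  refine card_nbij' (fun k => 2 * (n : ℤ) - 2 - k) (fun k => 2 * (n : ℤ) - 2 - k) ?_ ?_ ?_ ?_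
  · intro k hk
    simp only [coe_filter, Finset.mem_Icc, Set.mem_ofPred_eq] at hk ⊢
    refine ⟨by omega, ?_⟩
    rintro ⟨x, hx, y, hy, h⟩
    have := hS x hx
    have := hS y hy
    exact hk.2 ⟨n - 1 - x, mem_image_of_mem _ hx, n - 1 - y, mem_image_of_mem _ hy, by omega⟩
  · intro k hk
    simp only [coe_filter, Finset.mem_Icc, Set.mem_ofPred_eq] at hk ⊢
    refine ⟨by omega, ?_⟩
    rintro ⟨x', hx', y', hy', h⟩
    obtain ⟨x, hx, rfl⟩ := mem_image.1 hx'
    obtain ⟨y, hy, rfl⟩ := mem_image.1 hy'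
    have := hS x hx
    have := hS y hy
    exact hk.2 ⟨x, hx, y, hy, by omega⟩
  · intro k _; dsimp only; omega
  · intro k _; dsimp only; omega

/-- The number of subsets of `{0, …, M - 1}` containing `0` that miss `i` sums below `M`. -/
noncomputable def lowCount (M i : ℕ) : ℕ :=
  subsetCount (range M) (fun S => 0 ∈ S ∧ missSum S 0 ((M : ℤ) - 1) = i)

theorem pR'_eq (n i : ℕ) :
    pR' n (fun S => missSum S 0 ((n : ℤ) - 1) = i) = lowCount n i / 2 ^ (n - 1) := by
  unfold pR' lowCount subsetCount
  congr!

theorem pR''_eq (n : ℕ) (p : Finset ℕ → Prop) :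
    pR'' n p = subsetCount (range n) (fun S => 0 ∈ S ∧ n - 1 ∈ S ∧ p S) / 2 ^ (n - 2) := by
  unfold pR'' subsetCount
  congr!

theorem subsetCount_low {n M : ℕ} (hM : 1 ≤ M) (hn : M ≤ n) (i : ℕ) :
    subsetCount (range n) (fun S => 0 ∈ S ∧ missSum S 0 ((M : ℤ) - 1) = i) =
      lowCount M i * 2 ^ (n - M) := by
  have hU : range n = range M ∪ Finset.Ico M n := by
    ext x; simp only [Finset.mem_range, mem_union, Finset.mem_Ico]; omega
  have hd : Disjoint (range M) (Finset.Ico M n) := by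
    rw [Finset.disjoint_left]; intro x; simp only [Finset.mem_range, Finset.mem_Ico]; omega
  rw [hU, subsetCount_union hd (p := fun S => 0 ∈ S ∧ missSum S 0 ((M : ℤ) - 1) = i)
    (q := fun _ => True), subsetCount_true, Nat.card_Ico, lowCount]
  intro A hA B hB
  have hB' : ∀ x ∈ B, M ≤ x := fun x hx => (Finset.mem_Ico.1 (hB hx)).1
  have h0 : 0 ∉ B := fun h => by have := hB' 0 h; omega
  rw [missSum_union_low hB', mem_union]
  tauto

theorem subsetCount_high {n M : ℕ} (hM : 1 ≤ M) (hn : M ≤ n) (i : ℕ) :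
    subsetCount (Finset.Ico (n - M) n) (fun S => n - 1 ∈ S ∧
      missSum S (2 * (n : ℤ) - 1 - M) (2 * (n : ℤ) - 2) = i) = lowCount M i := by
  classical
  unfold lowCount subsetCount
  symm
  have hinv : ∀ S : Finset ℕ, (∀ x ∈ S, x < n) →
      (S.image (fun x => n - 1 - x)).image (fun x => n - 1 - x) = S := by
    intro S hS
    rw [image_image]
    conv_rhs => rw [← image_id (s := S)]
    refine image_congr fun x hx => ?_
    have := hS x hx
    simp only [Function.comp, id]
    omega
  refine card_nbij' (fun S => S.image (fun x => n - 1 - x))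
    (fun S => S.image (fun x => n - 1 - x)) ?_ ?_ ?_ ?_
  · intro S hS
    simp only [coe_filter, mem_powerset, Set.mem_ofPred_eq] at hS ⊢
    obtain ⟨h1, h2, h3⟩ := hS
    have hlt : ∀ x ∈ S, x < M := fun x hx => Finset.mem_range.1 (h1 hx)
    refine ⟨?_, mem_image.2 ⟨0, h2, by omega⟩, ?_⟩
    · intro y hy
      obtain ⟨x, hx, rfl⟩ := mem_image.1 hy
      have := hlt x hx
      rw [Finset.mem_Ico]; omega
    · rw [missSum_reflect fun x hx => (hlt x hx).trans_le hn, h3]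
  · intro S hS
    simp only [coe_filter, mem_powerset, Set.mem_ofPred_eq] at hS ⊢
    obtain ⟨h1, h2, h3⟩ := hS
    have hlt : ∀ x ∈ S, n - M ≤ x ∧ x < n := fun x hx => Finset.mem_Ico.1 (h1 hx)
    refine ⟨?_, mem_image.2 ⟨n - 1, h2, by omega⟩, ?_⟩
    · intro y hy
      obtain ⟨x, hx, rfl⟩ := mem_image.1 hy
      have := hlt x hx
      rw [Finset.mem_range]; omega
    · rw [← h3, ← missSum_reflect (n := n), hinv S fun x hx => (hlt x hx).2]
      intro y hy
      obtain ⟨x, hx, rfl⟩ := mem_image.1 hy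
      omega
  · intro S hS
    simp only [coe_filter, mem_powerset, Set.mem_ofPred_eq] at hS
    exact hinv S fun x hx => (Finset.mem_range.1 (hS.1 hx)).trans_le hn
  · intro S hS
    simp only [coe_filter, mem_powerset, Set.mem_ofPred_eq] at hS
    exact hinv S fun x hx => (Finset.mem_Ico.1 (hS.1 hx)).2

/-- The two fringes of a random set are independent. -/
theorem subsetCount_low_high {n M : ℕ} (hM : 1 ≤ M) (hn : 2 * M ≤ n) (i j : ℕ) :
    subsetCount (range n) (fun S => 0 ∈ S ∧ n - 1 ∈ S ∧ missSum S 0 ((M : ℤ) - 1) = i ∧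
      missSum S (2 * (n : ℤ) - 1 - M) (2 * (n : ℤ) - 2) = j) =
      lowCount M i * lowCount M j * 2 ^ (n - 2 * M) := by
  have hU : range n = range (n - M) ∪ Finset.Ico (n - M) n := by
    ext x; simp only [Finset.mem_range, mem_union, Finset.mem_Ico]; omega
  have hd : Disjoint (range (n - M)) (Finset.Ico (n - M) n) := by
    rw [Finset.disjoint_left]; intro x; simp only [Finset.mem_range, Finset.mem_Ico]; omega
  rw [hU, subsetCount_union hd (p := fun S => 0 ∈ S ∧ missSum S 0 ((M : ℤ) - 1) = i)
    (q := fun S => n - 1 ∈ S ∧ missSum S (2 * (n : ℤ) - 1 - M) (2 * (n : ℤ) - 2) = j),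
    subsetCount_low hM (by omega), subsetCount_high hM (by omega),
    show n - M - M = n - 2 * M by omega]
  · ring
  · intro A hA B hB
    have hA' : ∀ x ∈ A, x < n - M := fun x hx => Finset.mem_range.1 (hA hx)
    have hB' : ∀ x ∈ B, n - M ≤ x ∧ x < n := fun x hx => Finset.mem_Ico.1 (hB hx)
    have h0 : 0 ∉ B := fun h => by have := hB' 0 h; omega
    have h1 : n - 1 ∉ A := fun h => by have := hA' _ h; omega
    rw [missSum_union_low fun x hx => by have := hB' x hx; omega,
      missSum_union_high (by omega) hA' fun x hx => (hB' x hx).2, mem_union, mem_union]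
    tauto

theorem subsetCount_low_add_high {n M : ℕ} (hM : 1 ≤ M) (hn : 2 * M ≤ n) (m : ℕ) :
    subsetCount (range n) (fun S => 0 ∈ S ∧ n - 1 ∈ S ∧ missSum S 0 ((M : ℤ) - 1) +
      missSum S (2 * (n : ℤ) - 1 - M) (2 * (n : ℤ) - 2) = m) =
      (∑ i ∈ range (m + 1), lowCount M i * lowCount M (m - i)) * 2 ^ (n - 2 * M) := by
  classical
  rw [sum_mul]
  simp_rw [← subsetCount_low_high hM hn]
  unfold subsetCount
  rw [card_eq_sum_card_fiberwise (f := fun S => missSum S 0 ((M : ℤ) - 1)) (t := range (m + 1))]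
  · refine sum_congr rfl fun i hi => ?_
    congr 1
    ext S
    rw [Finset.mem_range] at hi
    simp only [mem_filter, mem_powerset]
    constructor
    · rintro ⟨⟨h0, h1, h2, h3⟩, h4⟩
      exact ⟨h0, h1, h2, h4, by omega⟩
    · rintro ⟨h0, h1, h2, h3, h4⟩
      exact ⟨⟨h0, h1, h2, by omega⟩, h3⟩
  · intro S hS
    simp only [coe_filter, mem_powerset, Set.mem_ofPred_eq] at hS
    simp only [coe_range, Set.mem_Iio]
    omega

theorem abs_lowProb_sub_le {n M : ℕ} (hM : 1 ≤ M) (hn : M ≤ n) (i : ℕ) :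
    |(lowCount n i : ℝ) / 2 ^ (n - 1) - lowCount M i / 2 ^ (M - 1)| ≤ 16 * (7 / 8) ^ M := by
  have h1 : |(lowCount n i : ℝ) - subsetCount (range n)
      (fun S => 0 ∈ S ∧ missSum S 0 ((M : ℤ) - 1) = i)| ≤ _ :=
    (abs_subsetCount_sub_le (r := fun S => ∃ k ∈ Finset.Ico M n, IsMissingSum k S) (by
      intro S _ hr
      rw [missSum_add S (b := (M : ℤ) - 1) (by omega) (by omega),
        missSum_eq_zero (c := (M : ℤ) - 1 + 1) (by ring) (by omega) hr, add_zero])).trans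
      (subsetCount_exists_isMissingSum_low_le n M)
  rw [subsetCount_low hM hn] at h1
  have e1 : (2 : ℝ) ^ n = 2 * 2 ^ (n - 1) := by rw [← pow_succ']; congr 1; omega
  have e2 : (2 : ℝ) ^ (n - 1) = 2 ^ (M - 1) * 2 ^ (n - M) := by
    rw [← pow_add]; congr 1; omega
  have e3 : (lowCount n i : ℝ) / 2 ^ (n - 1) - lowCount M i / 2 ^ (M - 1) =
      (lowCount n i - (lowCount M i * 2 ^ (n - M) : ℕ)) / 2 ^ (n - 1) := by
    rw [e2]; push_cast; field_simp
  rw [e3, abs_div, abs_of_pos (show (0 : ℝ) < 2 ^ (n - 1) by positivity),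
    div_le_iff₀ (by positivity)]
  rw [e1] at h1
  linarith

theorem abs_pR''_sub_le {n M : ℕ} (hM : 1 ≤ M) (hn : 2 * M ≤ n) (m : ℕ) :
    |pR'' n (fun S => missSum S 0 (2 * (n : ℤ) - 2) = m) -
      ∑ i ∈ range (m + 1), (lowCount M i : ℝ) / 2 ^ (M - 1) *
        (lowCount M (m - i) / 2 ^ (M - 1))| ≤ 64 * (7 / 8) ^ M := by
  have h1 := (abs_subsetCount_sub_le (U := range n)
    (p := fun S => 0 ∈ S ∧ n - 1 ∈ S ∧ missSum S 0 (2 * (n : ℤ) - 2) = m)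
    (q := fun S => 0 ∈ S ∧ n - 1 ∈ S ∧ missSum S 0 ((M : ℤ) - 1) +
      missSum S (2 * (n : ℤ) - 1 - M) (2 * (n : ℤ) - 2) = m)
    (r := fun S => ∃ k ∈ Finset.Ico M (2 * n - 1 - M), IsMissingSum k S) (by
      intro S _ hr
      rw [missSum_add S (b := (M : ℤ) - 1) (by omega) (by omega),
        missSum_add S (a := (M : ℤ) - 1 + 1) (b := 2 * (n : ℤ) - 2 - M) (by omega) (by omega),
        missSum_eq_zero (c := (M : ℤ) - 1 + 1) (by ring) (by omega) hr, zero_add,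
        show 2 * (n : ℤ) - 2 - M + 1 = 2 * (n : ℤ) - 1 - M by ring])).trans
      (subsetCount_exists_isMissingSum_mid_le n M)
  rw [subsetCount_low_add_high hM hn] at h1
  have e1 : (2 : ℝ) ^ n = 4 * 2 ^ (n - 2) := by
    rw [show (4 : ℝ) = 2 ^ 2 by norm_num, ← pow_add]; congr 1; omega
  have e2 : (2 : ℝ) ^ (n - 2) = 2 ^ (M - 1) * 2 ^ (M - 1) * 2 ^ (n - 2 * M) := by
    rw [← pow_add, ← pow_add]; congr 1; omega
  have e3 : ∑ i ∈ range (m + 1), (lowCount M i : ℝ) / 2 ^ (M - 1) *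
        (lowCount M (m - i) / 2 ^ (M - 1)) =
      ((∑ i ∈ range (m + 1), lowCount M i * lowCount M (m - i)) * 2 ^ (n - 2 * M) : ℕ) /
        2 ^ (n - 2) := by
    rw [e2]
    push_cast
    rw [mul_div_mul_right _ _ (by positivity), sum_div]
    exact sum_congr rfl fun i _ => div_mul_div_comm _ _ _ _
  rw [pR''_eq, e3, ← sub_div, abs_div, abs_of_pos (show (0 : ℝ) < 2 ^ (n - 2) by positivity),
    div_le_iff₀ (by positivity)]
  rw [e1] at h1
  linarith

theorem exists_tendsto_lowProb (i : ℕ) :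
    ∃ l : ℝ, Tendsto (fun n : ℕ => (lowCount n i : ℝ) / 2 ^ (n - 1)) atTop (nhds l) := by
  refine cauchySeq_tendsto_of_complete (Metric.cauchySeq_iff'.2 fun ε hε => ?_)
  have ht : Tendsto (fun M : ℕ => 16 * (7 / 8 : ℝ) ^ M) atTop (nhds (16 * 0)) :=
    (tendsto_pow_atTop_nhds_zero_of_lt_one (by norm_num) (by norm_num)).const_mul _
  rw [mul_zero] at ht
  obtain ⟨M, hM, hM1⟩ := ((ht.eventually_lt_const hε).and (eventually_ge_atTop 1)).exists
  exact ⟨M, fun n hn => (abs_lowProb_sub_le hM1 hn i).trans_lt hM⟩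

/-- For every nonnegative integer `m`,
`lim_{n→∞} P(f⁺_{[0,2n-2]}(R_n'') = m) = Σ_{i=0}^m lim P(f⁺_{[0,n-1]}(R_n') = i) · lim P(f⁺_{[0,n-1]}(R_n') = m-i)`,
where all the indicated limits exist. -/
theorem missing_sums_all_eq_convolution' (m : ℕ) :
    ∃ L : ℕ → ℝ,
      (∀ i ≤ m, Tendsto (fun n : ℕ => pR' n (fun S => missSum S 0 ((n : ℤ) - 1) = i))
        atTop (nhds (L i))) ∧
      Tendsto (fun n : ℕ => pR'' n (fun S => missSum S 0 (2 * (n : ℤ) - 2) = m)) atTop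
        (nhds (∑ i ∈ Finset.range (m + 1), L i * L (m - i))) := by
  choose L hL using exists_tendsto_lowProb
  refine ⟨L, fun i _ => by simpa only [pR'_eq] using hL i, ?_⟩
  have hhalf : Tendsto (fun n : ℕ => n / 2) atTop atTop := Nat.tendsto_div_const_atTop two_ne_zero
  have hconv : Tendsto (fun n : ℕ => ∑ i ∈ range (m + 1),
      (lowCount (n / 2) i : ℝ) / 2 ^ (n / 2 - 1) *
        (lowCount (n / 2) (m - i) / 2 ^ (n / 2 - 1))) atTop
      (nhds (∑ i ∈ range (m + 1), L i * L (m - i))) :=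
    tendsto_finsetSum _ fun i _ => ((hL i).comp hhalf).mul ((hL (m - i)).comp hhalf)
  have hpow : Tendsto (fun n : ℕ => 64 * (7 / 8 : ℝ) ^ (n / 2)) atTop (nhds (64 * 0)) :=
    ((tendsto_pow_atTop_nhds_zero_of_lt_one (by norm_num) (by norm_num)).comp hhalf).const_mul _
  rw [mul_zero] at hpow
  have hdiff := squeeze_zero_norm' (a := fun n : ℕ => 64 * (7 / 8 : ℝ) ^ (n / 2))
    (f := fun n : ℕ => pR'' n (fun S => missSum S 0 (2 * (n : ℤ) - 2) = m) -
      ∑ i ∈ range (m + 1), (lowCount (n / 2) i : ℝ) / 2 ^ (n / 2 - 1) *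
        (lowCount (n / 2) (m - i) / 2 ^ (n / 2 - 1)))
    (by
      filter_upwards [eventually_ge_atTop 2] with n hn
      exact abs_pR''_sub_le (by omega) (by omega) m) hpow
  simpa using hdiff.add hconv
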